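/- Let m ≥ 3 be an integer, let B_m(2) be the m×m real matrix defined below, and let Δ(m) = ∑_{k=0}^{m} [binom(m,k) / (k·λ₁ + (m−k)·λ₂ − (m−4))] · (λ₂/√17)^k · (−λ₁/√17)^{m−k}, where λ₁ = (3−√17)/2 and λ₂ = (3+√17)/2. Then det B_m(2) ≠ 0 if and only if 4·Δ(m) ≠ 1 (i.e. if and only if Δ(m)^{−1} ≠ 4). -/

import Mathlib

/-- The matrix `B_m(2)` of the paper: `m × m`, first row `(B_m(2))_{0,j} = j + 2`,
and for `1 ≤ i ≤ m-1`: `(B_m(2))_{i,i-1} = m - i`, `(B_m(2))_{i,i} = 3i + 7 - m`,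
`(B_m(2))_{i,i+1} = 2(i+2)`, all other entries `0`. -/
noncomputable def paperB2 (m : ℕ) : Matrix (Fin m) (Fin m) ℝ :=
  Matrix.of fun i j =>
    if (i : ℕ) = 0 then ((j : ℕ) : ℝ) + 2
    else if (i : ℕ) = (j : ℕ) then 3 * ((i : ℕ) : ℝ) + 7 - (m : ℝ)
    else if (i : ℕ) = (j : ℕ) + 1 then (m : ℝ) - ((i : ℕ) : ℝ)
    else if (j : ℕ) = (i : ℕ) + 1 then 2 * (((i : ℕ) : ℝ) + 2)
    else 0

/-- The quantity `Δ(m)` of the paper, with `λ₁ = (3-√17)/2` and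
`λ₂ = (3+√17)/2` (so `λ₂ - λ₁ = √17`). -/
noncomputable def paperDelta (m : ℕ) : ℝ :=
  ∑ k ∈ Finset.range (m + 1),
    (Nat.choose m k : ℝ) /
        ((k : ℝ) * ((3 - Real.sqrt 17) / 2) + ((m : ℝ) - (k : ℝ)) * ((3 + Real.sqrt 17) / 2)
          - ((m : ℝ) - 4)) *
      (((3 + Real.sqrt 17) / 2) / Real.sqrt 17) ^ k *
      ((-((3 - Real.sqrt 17) / 2)) / Real.sqrt 17) ^ (m - k)

open Polynomial in
/-- First-order differential operator attached to the matrix. -/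
noncomputable def opL (m : ℕ) (p : ℝ[X]) : ℝ[X] :=
  (C 2 + C 3 * X - X ^ 2) * derivative p + (C (4 - (m : ℝ)) + C (m : ℝ) * X) * p

open Polynomial in
lemma opL_coeff_zero (m : ℕ) (p : ℝ[X]) :
    (opL m p).coeff 0 = 2 * p.coeff 1 + (4 - (m : ℝ)) * p.coeff 0 := by
  simp [opL, mul_coeff_zero, coeff_derivative]

open Polynomial in
lemma opL_coeff_succ (m n : ℕ) (p : ℝ[X]) :
    (opL m p).coeff (n + 1) = ((m : ℝ) - n) * p.coeff n
      + (3 * ((n : ℝ) + 1) + 4 - m) * p.coeff (n + 1) + 2 * ((n : ℝ) + 2) * p.coeff (n + 2) := by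
  have e : opL m p = C 2 * derivative p + C 3 * (X * derivative p) - X * (X * derivative p)
      + C (4 - (m : ℝ)) * p + C (m : ℝ) * (X * p) := by
    unfold opL; ring
  rw [e]
  simp only [coeff_add, coeff_sub, coeff_C_mul, coeff_X_mul]
  rcases n with _ | n
  · simp [coeff_derivative, mul_coeff_zero]; ring
  · simp only [coeff_X_mul, coeff_derivative]; push_cast; ring

open Polynomial in
lemma opL_eval_one (m : ℕ) (p : ℝ[X]) :
    (opL m p).eval 1 = 4 * (p.eval 1 + (derivative p).eval 1) := by
  simp [opL]; ring

lemma irr_ne (m r : ℕ) : (m : ℝ) * ((3 - Real.sqrt 17) / 2) + 4 - m + r * Real.sqrt 17 ≠ 0 := by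
  intro h
  have hs : Irrational (Real.sqrt 17) := by
    have := Nat.Prime.irrational_sqrt (p := 17) (by norm_num)
    simpa using this
  have h1 : ((m : ℝ) - 2 * r) * Real.sqrt 17 = m + 8 := by linarith
  have hne : (m : ℝ) - 2 * r ≠ 0 := by
    intro h0
    rw [h0] at h1
    have : (0 : ℝ) ≤ m := Nat.cast_nonneg m
    linarith
  apply hs
  refine ⟨((m : ℚ) + 8) / ((m : ℚ) - 2 * r), ?_⟩
  push_cast
  rw [div_eq_iff hne]
  linarith

open Polynomial in
lemma opL_inj (m : ℕ) (h : ℝ[X]) (hh : opL m h = 0) : h = 0 := by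
  by_contra hne
  set a : ℝ := (3 - Real.sqrt 17) / 2 with ha
  set b : ℝ := (3 + Real.sqrt 17) / 2 with hb
  have hs : Real.sqrt 17 ^ 2 = 17 := Real.sq_sqrt (by norm_num)
  obtain ⟨u, hu, hnd⟩ := exists_eq_pow_rootMultiplicity_mul_and_not_dvd h hne a
  set r := rootMultiplicity a h
  have hsum : C a + C b = (C 3 : ℝ[X]) := by rw [← C_add]; congr 1; rw [ha, hb]; ring
  have hprod : C a * C b = (-C 2 : ℝ[X]) := by
    rw [← C_mul, ← C_neg]; congr 1; rw [ha, hb]; linear_combination (-1 / 4) * hs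
  have hquad : (C 2 + C 3 * X - X ^ 2 : ℝ[X]) = -((X - C a) * (X - C b)) := by
    linear_combination (-X) * hsum + hprod
  have hder : (X - C a) * derivative h
      = (X - C a) ^ r * (C (r : ℝ) * u + (X - C a) * derivative u) := by
    rw [hu]
    rcases Nat.eq_zero_or_pos r with h0 | h0
    · simp [h0]
    · obtain ⟨t, ht⟩ := Nat.exists_eq_succ_of_ne_zero h0.ne'
      rw [ht]
      simp [derivative_mul, derivative_pow]
      ring
  have hx : (X - C a) ^ r * (-(X - C b) * (C (r : ℝ) * u + (X - C a) * derivative u)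
      + (C (4 - (m : ℝ)) + C (m : ℝ) * X) * u) = 0 := by
    rw [← hh]
    unfold opL
    rw [hquad]
    linear_combination (X - C b) * hder - (C (4 - (m : ℝ)) + C (m : ℝ) * X) * hu
  have hx2 := (mul_eq_zero.mp hx).resolve_left (pow_ne_zero _ (X_sub_C_ne_zero a))
  have hx3 := congrArg (eval a) hx2
  simp at hx3
  have hua : eval a u ≠ 0 := fun h0 => hnd (dvd_iff_isRoot.mpr h0)
  apply irr_ne m r
  apply mul_right_cancel₀ hua
  rw [zero_mul, ← hx3, hb, ha]
  ring

open Polynomial in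
lemma mulVec_iff (m : ℕ) (hm : 3 ≤ m) (p : ℝ[X]) (hd : p.natDegree ≤ m) (h0 : p.coeff 0 = 0) :
    (paperB2 m).mulVec (fun i => p.coeff ((i : ℕ) + 1)) = 0 ↔
      ∃ a : ℝ, opL m p = C a * (1 - X) := by
  have hrow0 : (paperB2 m).mulVec (fun i => p.coeff ((i : ℕ) + 1)) ⟨0, by omega⟩
      = p.eval 1 + (derivative p).eval 1 := by
    have e1 : p.eval 1 = ∑ j ∈ Finset.range m, p.coeff (j + 1) := by
      rw [eval_eq_sum_range' (n := m + 1) (by omega), Finset.sum_range_succ']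
      simp [h0]
    have e2 : (derivative p).eval 1 = ∑ j ∈ Finset.range m, p.coeff (j + 1) * (j + 1) := by
      have : (derivative p).natDegree < m := by
        have := natDegree_derivative_le p
        omega
      rw [eval_eq_sum_range' this]
      simp [coeff_derivative]
    rw [e1, e2, ← Finset.sum_add_distrib, Matrix.mulVec, dotProduct]
    rw [← Fin.sum_univ_eq_sum_range (fun j => p.coeff (j + 1) + p.coeff (j + 1) * ((j : ℝ) + 1)) m]
    refine Finset.sum_congr rfl fun j _ => ?_
    simp [paperB2]; ring
  have hrow : ∀ n : ℕ, ∀ hn : n + 1 < m,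
      (paperB2 m).mulVec (fun i => p.coeff ((i : ℕ) + 1)) ⟨n + 1, hn⟩
      = (opL m p).coeff (n + 2) := by
    intro n hn
    rw [opL_coeff_succ, Matrix.mulVec, dotProduct]
    have : ∀ j : Fin m, paperB2 m ⟨n + 1, hn⟩ j * p.coeff ((j : ℕ) + 1) =
        (fun j : ℕ => (if n = j then ((m : ℝ) - (n + 1 : ℕ)) * p.coeff (n + 1) else 0)
        + (if n + 1 = j then (3 * ((n + 1 : ℕ) + 1 : ℝ) + 4 - m) * p.coeff (n + 2) else 0)
        + (if n + 2 = j then (2 * ((n + 1 : ℕ) + 2 : ℝ)) * p.coeff (n + 3) else 0)) (j : ℕ) := by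
      intro j
      obtain ⟨j, hj⟩ := j
      simp only [paperB2, Matrix.of_apply]
      rw [if_neg (by omega)]
      by_cases c1 : n + 1 = j
      · subst c1; simp; left; ring
      by_cases c2 : n = j
      · subst c2; simp
      by_cases c3 : n + 2 = j
      · subst c3; simp
      · rw [if_neg c1, if_neg (by omega), if_neg (by omega)]
        simp [c1, c2, c3]
    refine ((Finset.sum_congr rfl fun j _ => this j).trans (Fin.sum_univ_eq_sum_range
      (fun j : ℕ => (if n = j then ((m : ℝ) - (n + 1 : ℕ)) * p.coeff (n + 1) else 0)
        + (if n + 1 = j then (3 * ((n + 1 : ℕ) + 1 : ℝ) + 4 - m) * p.coeff (n + 2) else 0)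
        + (if n + 2 = j then (2 * ((n + 1 : ℕ) + 2 : ℝ)) * p.coeff (n + 3) else 0)) m)).trans ?_
    rw [Finset.sum_add_distrib, Finset.sum_add_distrib, Finset.sum_ite_eq, Finset.sum_ite_eq,
      Finset.sum_ite_eq, if_pos (by simp; omega), if_pos (by simp; omega)]
    split_ifs with c
    · rfl
    · have : p.coeff (n + 3) = 0 := by
        apply coeff_eq_zero_of_natDegree_lt
        simp at c; omega
      simp [this]
  constructor
  · intro h
    have hev : (opL m p).eval 1 = 0 := by
      rw [opL_eval_one, ← hrow0, h]; simp
    have hlin : opL m p = C ((opL m p).coeff 0) + C ((opL m p).coeff 1) * X := by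
      ext n
      rcases n with _ | _ | n
      · simp
      · simp [coeff_C]
      · have : (opL m p).coeff (n + 2) = 0 := by
          by_cases hn : n + 1 < m
          · rw [← hrow n hn, h]; rfl
          · rw [opL_coeff_succ, coeff_eq_zero_of_natDegree_lt (n := n + 1 + 1) (by omega),
              coeff_eq_zero_of_natDegree_lt (n := n + 1 + 2) (by omega)]
            rcases Nat.lt_or_ge m (n + 1) with c | c
            · rw [coeff_eq_zero_of_natDegree_lt (n := n + 1) (by omega)]; simp
            · have : m = n + 1 := by omega
              subst this; simp
        rw [this]
        simp [coeff_C, coeff_X]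
    refine ⟨(opL m p).coeff 0, ?_⟩
    have hab : (opL m p).coeff 0 + (opL m p).coeff 1 = 0 := by
      rw [hlin] at hev
      simpa using hev
    have hb : (opL m p).coeff 1 = -(opL m p).coeff 0 := by linarith
    rw [hb, C_neg] at hlin
    linear_combination hlin
  · rintro ⟨a, ha⟩
    funext i
    obtain ⟨i, hi⟩ := i
    rcases i with _ | n
    · rw [hrow0]
      have := opL_eval_one m p
      rw [ha] at this
      simp at this
      simpa using this
    · rw [hrow n hi, ha]
      simp [coeff_one, coeff_X]

open Polynomial in
/-- The solution of `opL m G = 1`. -/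
noncomputable def polyG (m : ℕ) : ℝ[X] :=
  ∑ k ∈ Finset.range (m + 1),
    C ((Nat.choose m k : ℝ) /
        ((k : ℝ) * ((3 - Real.sqrt 17) / 2) + ((m : ℝ) - (k : ℝ)) * ((3 + Real.sqrt 17) / 2)
          - ((m : ℝ) - 4)) * (1 / Real.sqrt 17) ^ k * (1 / Real.sqrt 17) ^ (m - k)) *
      ((C ((3 + Real.sqrt 17) / 2) - X) ^ k *
      (X - C ((3 - Real.sqrt 17) / 2)) ^ (m - k))

open Polynomial in
lemma polyG_eval (m : ℕ) : (polyG m).coeff 0 = paperDelta m := by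
  rw [coeff_zero_eq_eval_zero, polyG, eval_finsetSum, paperDelta]
  refine Finset.sum_congr rfl fun k _ => ?_
  simp [div_pow]
  ring

open Polynomial in
lemma polyG_deg (m : ℕ) : (polyG m).natDegree ≤ m := by
  apply natDegree_sum_le_of_forall_le
  intro k hk
  have hk' : k ≤ m := by simp at hk; omega
  refine (natDegree_C_mul_le _ _).trans (natDegree_mul_le.trans ?_)
  have h1 : ((C ((3 + Real.sqrt 17) / 2) - X : ℝ[X]) ^ k).natDegree ≤ k := by
    refine natDegree_pow_le_of_le (m := 1) k ?_ |>.trans (by simp)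
    compute_degree
  have h2 : ((X - C ((3 - Real.sqrt 17) / 2) : ℝ[X]) ^ (m - k)).natDegree ≤ m - k := by
    refine natDegree_pow_le_of_le (m := 1) (m - k) ?_ |>.trans (by simp)
    compute_degree
  omega

open Polynomial in
lemma X_der_pow (q : ℝ[X]) (k : ℕ) :
    q * derivative (q ^ k) = C (k : ℝ) * q ^ k * derivative q := by
  rcases k with _ | k
  · simp
  · rw [derivative_pow]; simp; ring

open Polynomial in
lemma opL_basis (m k : ℕ) (hk : k ≤ m) :
    opL m ((C ((3 + Real.sqrt 17) / 2) - X) ^ k * (X - C ((3 - Real.sqrt 17) / 2)) ^ (m - k)) =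
    C ((k : ℝ) * ((3 - Real.sqrt 17) / 2) + ((m : ℝ) - (k : ℝ)) * ((3 + Real.sqrt 17) / 2)
          - ((m : ℝ) - 4)) * ((C ((3 + Real.sqrt 17) / 2) - X) ^ k *
      (X - C ((3 - Real.sqrt 17) / 2)) ^ (m - k)) := by
  set a : ℝ := (3 - Real.sqrt 17) / 2 with ha
  set b : ℝ := (3 + Real.sqrt 17) / 2 with hb
  have hs : Real.sqrt 17 ^ 2 = 17 := Real.sq_sqrt (by norm_num)
  have hsum : C a + C b = (C 3 : ℝ[X]) := by rw [← C_add]; congr 1; rw [ha, hb]; ring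
  have hprod : C a * C b = (-C 2 : ℝ[X]) := by
    rw [← C_mul, ← C_neg]; congr 1; rw [ha, hb]; linear_combination (-1 / 4) * hs
  have hquad : (C 2 + C 3 * X - X ^ 2 : ℝ[X]) = (X - C a) * (C b - X) := by
    linear_combination (-X) * hsum + hprod
  have d1 := X_der_pow (C b - X) k
  have d2 := X_der_pow (X - C a) (m - k)
  rw [Nat.cast_sub hk] at d2
  simp only [derivative_sub, derivative_C, derivative_X, C_sub] at d1 d2
  unfold opL
  rw [hquad, derivative_mul]
  simp only [C_sub, C_add, C_mul]
  linear_combination (X - C a) * (X - C a) ^ (m - k) * d1 + (C b - X) * (C b - X) ^ k * d2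

open Polynomial in
lemma opL_polyG (m : ℕ) : opL m (polyG m) = 1 := by
  have hs : Real.sqrt 17 ≠ 0 := by positivity
  have lin : opL m (polyG m) = ∑ k ∈ Finset.range (m + 1),
    C ((Nat.choose m k : ℝ) /
        ((k : ℝ) * ((3 - Real.sqrt 17) / 2) + ((m : ℝ) - (k : ℝ)) * ((3 + Real.sqrt 17) / 2)
          - ((m : ℝ) - 4)) * (1 / Real.sqrt 17) ^ k * (1 / Real.sqrt 17) ^ (m - k)) *
      opL m ((C ((3 + Real.sqrt 17) / 2) - X) ^ k *
      (X - C ((3 - Real.sqrt 17) / 2)) ^ (m - k)) := by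
    simp only [opL, polyG, derivative_sum, Finset.mul_sum, ← Finset.sum_add_distrib,
      derivative_C_mul]
    refine Finset.sum_congr rfl fun k _ => ?_
    ring
  rw [lin]
  have one : (1 : ℝ[X]) = (C (1 / Real.sqrt 17) * (C ((3 + Real.sqrt 17) / 2) - X)
      + C (1 / Real.sqrt 17) * (X - C ((3 - Real.sqrt 17) / 2))) ^ m := by
    have : C (1 / Real.sqrt 17) * (C ((3 + Real.sqrt 17) / 2) - X)
      + C (1 / Real.sqrt 17) * (X - C ((3 - Real.sqrt 17) / 2)) = (1 : ℝ[X]) := by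
      have e : (1 / Real.sqrt 17) * (((3 + Real.sqrt 17) / 2) - ((3 - Real.sqrt 17) / 2)) = 1 := by
        field_simp; ring
      have e' := congrArg (C : ℝ → ℝ[X]) e
      rw [C_mul, C_sub, C_1] at e'
      rw [← e']; ring
    rw [this, one_pow]
  rw [one, add_pow]
  refine Finset.sum_congr rfl fun k hk => ?_
  have hk' : k ≤ m := by simp at hk; omega
  rw [opL_basis m k hk']
  have hD : ((k : ℝ) * ((3 - Real.sqrt 17) / 2) + ((m : ℝ) - (k : ℝ)) * ((3 + Real.sqrt 17) / 2)
          - ((m : ℝ) - 4)) ≠ 0 := by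
    have := irr_ne m (m - k)
    rw [Nat.cast_sub hk'] at this
    intro h; apply this; rw [← h]; ring
  generalize ((k : ℝ) * ((3 - Real.sqrt 17) / 2) + ((m : ℝ) - (k : ℝ)) * ((3 + Real.sqrt 17) / 2)
          - ((m : ℝ) - 4)) = D at hD
  have hc : C ((Nat.choose m k : ℝ) / D * (1 / Real.sqrt 17) ^ k * (1 / Real.sqrt 17) ^ (m - k))
      * C D = (C (1 / Real.sqrt 17)) ^ k * (C (1 / Real.sqrt 17)) ^ (m - k)
        * (Nat.choose m k : ℝ[X]) := by
    rw [← C_mul, ← C_pow, ← C_pow, ← C_mul, ← C_eq_natCast, ← C_mul]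
    congr 1
    rw [show ((Nat.choose m k : ℝ) / D * (1 / Real.sqrt 17) ^ k * (1 / Real.sqrt 17) ^ (m - k)) * D
      = ((Nat.choose m k : ℝ) / D * D) * ((1 / Real.sqrt 17) ^ k * (1 / Real.sqrt 17) ^ (m - k))
      by ring, div_mul_cancel₀ _ hD, mul_comm]
  rw [← mul_assoc, hc, mul_pow, mul_pow]
  ring

open Polynomial in
lemma det_zero_iff (m : ℕ) (hm : 3 ≤ m) : (paperB2 m).det = 0 ↔ 4 * paperDelta m = 1 := by
  have hm0 : (m : ℝ) ≠ 0 := by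
    have : m ≠ 0 := by omega
    exact_mod_cast this
  set g : ℝ[X] := C 4 * polyG m - 1 with hg
  have hLg : opL m g = C (m : ℝ) * (1 - X) := by
    have h1 : opL m g = C 4 * opL m (polyG m) - (C (4 - (m : ℝ)) + C (m : ℝ) * X) := by
      simp only [opL, hg, derivative_sub, derivative_C_mul, derivative_one]; ring
    rw [h1, opL_polyG, C_sub]; ring
  have hg0 : g.coeff 0 = 4 * paperDelta m - 1 := by
    rw [hg, coeff_sub, coeff_C_mul, polyG_eval]; simp
  have hgd : g.natDegree ≤ m := by
    refine (natDegree_sub_le _ _).trans ?_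
    simp only [natDegree_one, max_le_iff]
    exact ⟨(natDegree_C_mul_le _ _).trans (polyG_deg m), by omega⟩
  rw [← Matrix.exists_mulVec_eq_zero_iff]
  constructor
  · rintro ⟨v, hv, hB⟩
    set f : ℝ[X] := X * ofFn m v with hf
    have hfc : (fun i : Fin m => f.coeff ((i : ℕ) + 1)) = v := by
      funext i
      rw [hf, coeff_X_mul, ofFn_coeff_eq_val_of_lt v i.2]
    have hf0 : f.coeff 0 = 0 := by simp [hf]
    have hfd : f.natDegree ≤ m := by
      refine natDegree_mul_le.trans ?_
      have := ofFn_natDegree_lt (n := m) (by omega) v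
      rw [natDegree_X]; omega
    rw [← hfc] at hB
    obtain ⟨a, ha⟩ := (mulVec_iff m hm f hfd hf0).mp hB
    have hfg : f - C (a / m) * g = 0 := by
      apply opL_inj m
      have h1 : opL m (f - C (a / m) * g) = opL m f - C (a / m) * opL m g := by
        simp only [opL, derivative_sub, derivative_C_mul]; ring
      rw [h1, ha, hLg, ← mul_assoc, ← C_mul, div_mul_cancel₀ _ hm0, sub_self]
    have hfg' := sub_eq_zero.mp hfg
    have hc := congrArg (fun q : ℝ[X] => q.coeff 0) hfg'
    simp only [coeff_C_mul, hf0, hg0] at hc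
    rcases mul_eq_zero.mp hc.symm with h | h
    · exfalso
      apply hv
      rw [← hfc, hfg', h]
      funext i; simp
    · linarith
  · intro h
    have h0 : g.coeff 0 = 0 := by rw [hg0]; linarith
    refine ⟨fun i => g.coeff ((i : ℕ) + 1), ?_, (mulVec_iff m hm g hgd h0).mpr ⟨_, hLg⟩⟩
    intro hz
    have hgz : g = 0 := by
      ext n
      rcases n with _ | n
      · simpa using h0
      · by_cases hn : n < m
        · simpa using congrFun hz ⟨n, hn⟩
        · rw [coeff_eq_zero_of_natDegree_lt (by omega)]; simp
    rw [hgz] at hLg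
    have := congrArg (eval 0) hLg
    apply hm0
    simpa [opL] using this.symm

/-- `det B_m(2) ≠ 0` if and only if `Δ(m)⁻¹ ≠ 4`, i.e. `4·Δ(m) ≠ 1`. -/
theorem det_paperB2_ne_zero_iff (m : ℕ) (hm : 3 ≤ m) :
    (paperB2 m).det ≠ 0 ↔ 4 * paperDelta m ≠ 1 := by
  exact not_congr (det_zero_iff m hm)
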